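/- arXiv:1909.03286 — 3 statements merged into one kernel-verified Lean document; each statement's English description precedes it below -/
import Mathlib

section
/- Let G be a connected graph of order n with minimum degree δ and maximum degree Δ. Then avec(G) ≤ (9/4)·((n−Δ−1)/(δ+1))·(1 + (Δ−δ)/(3n)) + 7. -/
open SimpleGraph Finset

noncomputable def ecc {V : Type*} [Fintype V] (G : SimpleGraph V) (v : V) : ℕ :=
  Finset.univ.sup (G.dist v)

noncomputable def avec {V : Type*} [Fintype V] (G : SimpleGraph V) : ℝ :=
  (∑ v, (ecc G v : ℝ)) / (Fintype.card V)

/-- An integer metric `D` on the finite set `A` with interpolation, dominating a third of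
the graph distance, and with a small sum of eccentricities. -/
structure GoodMetric {V : Type*} (G : SimpleGraph V) (A : Finset V) (D : V → V → ℕ) : Prop where
  self : ∀ a ∈ A, D a a = 0
  symm : ∀ a ∈ A, ∀ b ∈ A, D a b = D b a
  interp : ∀ a ∈ A, ∀ b ∈ A, ∀ i j, i + j = D a b → ∃ c ∈ A, D a c = i ∧ D c b = j
  dist : ∀ a ∈ A, ∀ b ∈ A, G.dist a b ≤ 3 * D a b
  bdd : ∀ a ∈ A, ∀ b ∈ A, D a b + 1 ≤ A.card
  sum : 4 * (∑ a ∈ A, A.sup (D a)) + A.card ≤ 3 * A.card ^ 2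

lemma GoodMetric.single {V : Type*} (G : SimpleGraph V) (v : V) :
    GoodMetric G {v} (fun _ _ => 0) := by
  constructor <;> simp

lemma GoodMetric.count {V : Type*} [DecidableEq V] {G : SimpleGraph V} {A : Finset V}
    {D : V → V → ℕ} (h : GoodMetric G A D) (p : V) (hp : p ∈ A) :
    2 * (A.filter (fun x => D x p = A.sup (D x))).card + A.sup (D p) ≤ 2 * A.card := by
  obtain ⟨q, hq, hqe⟩ := Finset.exists_mem_eq_sup A ⟨p, hp⟩ (D p)
  set e := A.sup (D p) with he
  have h1 : Finset.range ((e + 1) / 2) ⊆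
      (A.filter (fun x => ¬ D x p = A.sup (D x))).image (D p) := by
    intro i hi
    rw [Finset.mem_range] at hi
    obtain ⟨c, hc, h2, h3⟩ := h.interp p hp q hq i (e - i) (by omega)
    rw [Finset.mem_image]
    refine ⟨c, ?_, h2⟩
    rw [Finset.mem_filter]
    refine ⟨hc, ?_⟩
    have h4 : D c q ≤ A.sup (D c) := Finset.le_sup (f := D c) hq
    have h5 := h.symm c hc p hp
    omega
  have h2 := Finset.card_le_card h1
  have h3 := h2.trans Finset.card_image_le
  rw [Finset.card_range] at h3
  have h4 := Finset.card_filter_add_card_filter_not (s := A) (fun x => D x p = A.sup (D x))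
  omega

lemma GoodMetric.extend {V : Type*} [DecidableEq V] {G : SimpleGraph V} (hG : G.Connected)
    {A : Finset V} {D : V → V → ℕ} (h : GoodMetric G A D) (p : V) (hp : p ∈ A) (l : V)
    (hl : l ∉ A) (hlp : G.dist l p ≤ 3) : ∃ DD, GoodMetric G (insert l A) DD := by
  set DD : V → V → ℕ := fun x y =>
    if x = l then (if y = l then 0 else D p y + 1) else (if y = l then D x p + 1 else D x y)
    with hDD
  have ll : DD l l = 0 := by simp [hDD]
  have ne : ∀ x ∈ A, x ≠ l := fun x hx he => hl (he ▸ hx)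
  have lx : ∀ x ∈ A, DD l x = D p x + 1 := fun x hx => by simp [hDD, ne x hx]
  have xl : ∀ x ∈ A, DD x l = D x p + 1 := fun x hx => by simp [hDD, ne x hx]
  have xy : ∀ x ∈ A, ∀ y ∈ A, DD x y = D x y := fun x hx y hy => by
    simp [hDD, ne x hx, ne y hy]
  have hcard : (insert l A).card = A.card + 1 := Finset.card_insert_of_notMem hl
  refine ⟨DD, ?_, ?_, ?_, ?_, ?_, ?_⟩
  · intro a ha
    rcases Finset.mem_insert.1 ha with rfl | ha
    · exact ll
    · rw [xy a ha a ha, h.self a ha]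
  · intro a ha b hb
    rw [Finset.mem_insert] at ha hb
    rcases ha with rfl | ha <;> rcases hb with rfl | hb
    · rfl
    · rw [lx b hb, xl b hb, h.symm p hp b hb]
    · rw [lx a ha, xl a ha, h.symm p hp a ha]
    · rw [xy a ha b hb, xy b hb a ha, h.symm a ha b hb]
  · intro a ha b hb i j hij
    rw [Finset.mem_insert] at ha hb
    rcases ha with rfl | ha <;> rcases hb with rfl | hb
    · refine ⟨b, Finset.mem_insert_self _ _, ?_, ?_⟩ <;> omega
    · rw [lx b hb] at hij
      rcases Nat.eq_zero_or_pos i with hi | hi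
      · refine ⟨a, Finset.mem_insert_self _ _, by omega, ?_⟩
        rw [lx b hb]; omega
      · obtain ⟨c, hc, h1, h2⟩ := h.interp p hp b hb (i - 1) j (by omega)
        refine ⟨c, Finset.mem_insert_of_mem hc, ?_, ?_⟩
        · rw [lx c hc]; omega
        · rw [xy c hc b hb]; omega
    · rw [xl a ha] at hij
      rcases Nat.eq_zero_or_pos j with hi | hi
      · refine ⟨b, Finset.mem_insert_self _ _, ?_, by omega⟩
        rw [xl a ha]; omega
      · obtain ⟨c, hc, h1, h2⟩ := h.interp a ha p hp i (j - 1) (by omega)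
        refine ⟨c, Finset.mem_insert_of_mem hc, ?_, ?_⟩
        · rw [xy a ha c hc]; omega
        · rw [xl c hc]; omega
    · rw [xy a ha b hb] at hij
      obtain ⟨c, hc, h1, h2⟩ := h.interp a ha b hb i j hij
      refine ⟨c, Finset.mem_insert_of_mem hc, ?_, ?_⟩
      · rw [xy a ha c hc]; omega
      · rw [xy c hc b hb]; omega
  · intro a ha b hb
    rw [Finset.mem_insert] at ha hb
    rcases ha with rfl | ha <;> rcases hb with rfl | hb
    · simp
    · rw [lx b hb]
      have := hG.dist_triangle (u := a) (v := p) (w := b)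
      have := h.dist p hp b hb
      omega
    · rw [xl a ha]
      have := hG.dist_triangle (u := a) (v := p) (w := b)
      have := h.dist a ha p hp
      rw [G.dist_comm] at hlp
      omega
    · rw [xy a ha b hb]
      exact h.dist a ha b hb
  · intro a ha b hb
    rw [hcard]
    rw [Finset.mem_insert] at ha hb
    rcases ha with rfl | ha <;> rcases hb with rfl | hb
    · omega
    · rw [lx b hb]
      have := h.bdd p hp b hb
      omega
    · rw [xl a ha]
      have := h.bdd a ha p hp
      omega
    · rw [xy a ha b hb]
      have := h.bdd a ha b hb
      omega
  · rw [hcard, Finset.sum_insert hl]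
    have e1 : (insert l A).sup (DD l) ≤ A.sup (D p) + 1 := by
      apply Finset.sup_le
      intro b hb
      rcases Finset.mem_insert.1 hb with rfl | hb
      · omega
      · rw [lx b hb]
        have : D p b ≤ A.sup (D p) := Finset.le_sup (f := D p) hb
        omega
    have e2 : ∀ x ∈ A, (insert l A).sup (DD x) ≤
        A.sup (D x) + (if D x p = A.sup (D x) then 1 else 0) := by
      intro x hx
      apply Finset.sup_le
      intro b hb
      rcases Finset.mem_insert.1 hb with rfl | hb
      · rw [xl x hx]
        have : D x p ≤ A.sup (D x) := Finset.le_sup (f := D x) hp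
        split_ifs <;> omega
      · rw [xy x hx b hb]
        have : D x b ≤ A.sup (D x) := Finset.le_sup (f := D x) hb
        omega
    have e3 := Finset.sum_le_sum e2
    rw [Finset.sum_add_distrib, ← Finset.card_filter] at e3
    have e4 := h.count p hp
    have e5 := h.sum
    have e6 : A.sup (D p) + 1 ≤ A.card := by
      obtain ⟨q, hq, hqe⟩ := Finset.exists_mem_eq_sup A ⟨p, hp⟩ (D p)
      rw [hqe]
      exact h.bdd p hp q hq
    nlinarith

/-- If some vertex is far from `A`, some vertex is at distance exactly three from `A`. -/
lemma exists_dist_three {V : Type*} {G : SimpleGraph V} (hG : G.Connected)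
    {A : Finset V} (v : V) (hv : v ∈ A) (u : V) (hu : ∀ b ∈ A, 3 ≤ G.dist u b) :
    ∃ x, (∀ b ∈ A, 3 ≤ G.dist x b) ∧ ∃ p ∈ A, G.dist x p ≤ 3 := by
  classical
  have hex : ∃ m, ∃ x, (∀ b ∈ A, 3 ≤ G.dist x b) ∧ ∃ p ∈ A, G.dist x p = m :=
    ⟨_, u, hu, v, hv, rfl⟩
  obtain ⟨x, hx, p, hp, hxp⟩ := Nat.find_spec hex
  refine ⟨x, hx, p, hp, ?_⟩
  by_contra hcon
  push Not at hcon
  obtain ⟨w, hw⟩ := hG.exists_walk_length_eq_dist x p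
  cases w with
  | nil => simp at hcon
  | cons hadj ww =>
    rename_i y
    rw [SimpleGraph.Walk.length_cons] at hw
    have h1 : G.dist y p ≤ ww.length := SimpleGraph.dist_le ww
    have h2 : G.dist x y ≤ 1 := by
      rw [SimpleGraph.dist_eq_one_iff_adj.2 hadj]
    have h3 : G.dist y p < Nat.find hex := by omega
    refine Nat.find_min hex h3 ⟨y, ?_, p, hp, rfl⟩
    intro b hb
    have h4 : Nat.find hex ≤ G.dist x b := Nat.find_min' hex ⟨x, hx, b, hb, rfl⟩
    have h5 := hG.dist_triangle (u := x) (v := y) (w := b)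
    omega

lemma exists_packing {V : Type*} [Fintype V] {G : SimpleGraph V} (hG : G.Connected) (v : V) :
    ∃ (A : Finset V) (D : V → V → ℕ), v ∈ A ∧ GoodMetric G A D ∧
      (∀ a ∈ A, ∀ b ∈ A, a ≠ b → 3 ≤ G.dist a b) ∧ ∀ u, ∃ a ∈ A, G.dist u a ≤ 2 := by
  classical
  let F : Finset (Finset V) := Finset.univ.filter (fun A => v ∈ A ∧ (∃ D, GoodMetric G A D) ∧
      (∀ a ∈ A, ∀ b ∈ A, a ≠ b → 3 ≤ G.dist a b))
  have hF : F.Nonempty := by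
    refine ⟨{v}, ?_⟩
    simp only [F, Finset.mem_filter, Finset.mem_univ, true_and]
    refine ⟨by simp, ⟨_, GoodMetric.single G v⟩, ?_⟩
    intro a ha b hb hab
    simp at ha hb
    exact absurd (ha.trans hb.symm) hab
  obtain ⟨A, hA, hmax⟩ := Finset.exists_max_image F Finset.card hF
  simp only [F, Finset.mem_filter, Finset.mem_univ, true_and] at hA hmax
  obtain ⟨hv, ⟨D, hD⟩, hpack⟩ := hA
  refine ⟨A, D, hv, hD, hpack, ?_⟩
  by_contra hcon
  push Not at hcon
  obtain ⟨u, hu⟩ := hcon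
  obtain ⟨x, hx, p, hp, hxp⟩ := exists_dist_three hG v hv u (fun b hb => hu b hb)
  have hxA : x ∉ A := by
    intro h
    have := hx x h
    simp at this
  have := hmax (insert x A) ⟨Finset.mem_insert_of_mem hv, hD.extend hG p hp x hxA hxp, ?_⟩
  · rw [Finset.card_insert_of_notMem hxA] at this
    omega
  · intro a ha b hb hab
    rw [Finset.mem_insert] at ha hb
    rcases ha with rfl | ha <;> rcases hb with rfl | hb
    · exact absurd rfl hab
    · exact hx b hb
    · rw [G.dist_comm]; exact hx a ha
    · exact hpack a ha b hb hab

theorem stmt3 {V : Type*} [Fintype V] (G : SimpleGraph V) [DecidableRel G.Adj]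
    (hG : G.Connected) (n δ Δ : ℕ) (hn : Fintype.card V = n)
    (hδ : G.minDegree = δ) (hΔ : G.maxDegree = Δ) :
    avec G ≤ (9 / 4) * (((n : ℝ) - Δ - 1) / (δ + 1)) * (1 + ((Δ : ℝ) - δ) / (3 * n)) + 7 := by
  classical
  have : Nonempty V := hG.nonempty
  obtain ⟨v, hv⟩ := G.exists_maximal_degree_vertex
  obtain ⟨A, D, hvA, hD, hpack, hcov⟩ := exists_packing hG v
  have hφ : ∀ u, ∃ a ∈ A, G.dist u a ≤ 2 ∧ ∀ b ∈ A, G.dist u b ≤ 1 → a = b := by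
    intro u
    by_cases h : ∃ b ∈ A, G.dist u b ≤ 1
    · obtain ⟨b, hb, hub⟩ := h
      refine ⟨b, hb, by omega, ?_⟩
      intro c hc huc
      by_contra hne
      have h1 := hpack b hb c hc hne
      have h2 := hG.dist_triangle (u := b) (v := u) (w := c)
      rw [G.dist_comm (u := b) (v := u)] at h2
      omega
    · obtain ⟨a, ha, hua⟩ := hcov u
      exact ⟨a, ha, hua, fun b hb hub => absurd ⟨b, hb, hub⟩ h⟩
  choose φ hφA hφ2 hφ1 using hφ
  have hecc : ∀ u, ecc G u ≤ 3 * A.sup (D (φ u)) + 4 := by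
    intro u
    apply Finset.sup_le
    intro x _
    have h1 := hG.dist_triangle (u := u) (v := φ u) (w := x)
    have h2 := hG.dist_triangle (u := φ u) (v := φ x) (w := x)
    have h3 := hφ2 u
    have h4 := hφ2 x
    rw [G.dist_comm] at h4
    have h5 := hD.dist _ (hφA u) _ (hφA x)
    have h6 : D (φ u) (φ x) ≤ A.sup (D (φ u)) := Finset.le_sup (f := D (φ u)) (hφA x)
    omega
  -- weights
  let w : V → ℕ := fun a => (Finset.univ.filter (fun u => φ u = a)).card
  have hw : ∀ a ∈ A, G.degree a + 1 ≤ w a := by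
    intro a ha
    have h1 : insert a (G.neighborFinset a) ⊆ Finset.univ.filter (fun u => φ u = a) := by
      intro u hu
      rw [Finset.mem_filter]
      refine ⟨Finset.mem_univ _, hφ1 u a ha ?_⟩
      rcases Finset.mem_insert.1 hu with rfl | hu
      · simp
      · rw [SimpleGraph.mem_neighborFinset] at hu
        rw [SimpleGraph.dist_eq_one_iff_adj.2 hu.symm]
    have h2 := Finset.card_le_card h1
    rw [Finset.card_insert_of_notMem (by simp), SimpleGraph.card_neighborFinset_eq_degree] at h2
    exact h2
  have hwsum : ∑ a ∈ A, w a = n := by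
    rw [← hn, ← Finset.card_univ]
    exact (Finset.card_eq_sum_card_fiberwise (fun u _ => hφA u)).symm
  have hwE : ∑ u, A.sup (D (φ u)) = ∑ a ∈ A, w a * A.sup (D a) := by
    rw [← Finset.sum_fiberwise_of_maps_to (t := A) (g := φ) (fun u _ => hφA u)]
    apply Finset.sum_congr rfl
    intro a _
    rw [Finset.sum_congr rfl (g := fun _ => A.sup (D a))
      (fun u hu => by rw [(Finset.mem_filter.1 hu).2])]
    simp [w]
  have hδΔ : δ ≤ Δ := by rw [← hδ, ← hΔ]; exact G.minDegree_le_maxDegree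
  let E : V → ℝ := fun a => (A.sup (D a) : ℕ)
  let c : V → ℝ := fun a => (δ + 1 : ℝ) + if a = v then (Δ - δ : ℝ) else 0
  have hc : ∀ a ∈ A, c a ≤ w a := by
    intro a ha
    have h1 := hw a ha
    have h2 := G.minDegree_le_degree a
    simp only [c]
    split_ifs with h
    · subst h
      rw [← hv, hΔ] at h1
      have : ((Δ + 1 : ℕ) : ℝ) ≤ w a := by exact_mod_cast h1
      push_cast at this
      linarith
    · have : ((δ + 1 : ℕ) : ℝ) ≤ w a := by exact_mod_cast (by omega : δ + 1 ≤ w a)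
      push_cast at this
      linarith
  have hEb : ∀ a ∈ A, E a ≤ A.card - 1 := by
    intro a ha
    obtain ⟨q, hq, hqe⟩ := Finset.exists_mem_eq_sup A ⟨a, ha⟩ (D a)
    have h1 := hD.bdd a ha q hq
    rw [← hqe] at h1
    have : ((A.sup (D a) + 1 : ℕ) : ℝ) ≤ A.card := by exact_mod_cast h1
    push_cast at this
    simp only [E]
    linarith
  have hsumc : ∑ a ∈ A, c a = (δ + 1) * A.card + (Δ - δ) := by
    simp only [c]
    rw [Finset.sum_add_distrib, Finset.sum_ite_eq' A v]
    simp [hvA]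
    ring
  have hsumcE : ∑ a ∈ A, c a * E a = (δ + 1) * ∑ a ∈ A, E a + (Δ - δ) * E v := by
    simp only [c, add_mul _ (ite _ _ _), ite_mul, zero_mul]
    rw [Finset.sum_add_distrib, Finset.sum_ite_eq' A v, if_pos hvA, ← Finset.mul_sum]
  have hwsumR : ∑ a ∈ A, (w a : ℝ) = n := by exact_mod_cast hwsum
  have hr : (0 : ℝ) ≤ n - ((δ + 1) * A.card + (Δ - δ)) := by
    rw [← hsumc, ← hwsumR]
    linarith [Finset.sum_le_sum hc]
  have hmain : ∑ a ∈ A, (w a : ℝ) * E a ≤ (δ + 1) * ∑ a ∈ A, E a + (Δ - δ) * (A.card - 1)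
      + (n - ((δ + 1) * A.card + (Δ - δ))) * (A.card - 1) := by
    have h1 : ∑ a ∈ A, ((w a : ℝ) - c a) * E a ≤ ∑ a ∈ A, ((w a : ℝ) - c a) * (A.card - 1) :=
      Finset.sum_le_sum fun a ha =>
        mul_le_mul_of_nonneg_left (hEb a ha) (by linarith [hc a ha])
    rw [← Finset.sum_mul, Finset.sum_sub_distrib, hwsumR, hsumc] at h1
    simp only [sub_mul _ _ (E _)] at h1
    rw [Finset.sum_sub_distrib, hsumcE] at h1
    have h2 : ((Δ : ℝ) - δ) * E v ≤ (Δ - δ) * (A.card - 1) :=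
      mul_le_mul_of_nonneg_left (hEb v hvA) (by
        have : (δ : ℝ) ≤ Δ := by exact_mod_cast hδΔ
        linarith)
    linarith
  have hS : 4 * (∑ a ∈ A, E a) + A.card ≤ 3 * (A.card : ℝ) ^ 2 := by
    have := hD.sum
    simp only [E]
    exact_mod_cast this
  have htot : ∑ u, (ecc G u : ℝ) ≤ 4 * n + 3 * ∑ a ∈ A, (w a : ℝ) * E a := by
    have h1 : ∑ u, ecc G u ≤ ∑ u, (3 * A.sup (D (φ u)) + 4) :=
      Finset.sum_le_sum fun u _ => hecc u
    rw [Finset.sum_add_distrib, ← Finset.mul_sum, hwE] at h1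
    simp only [Finset.sum_const, Finset.card_univ, hn, smul_eq_mul] at h1
    have h2 : ((∑ u, ecc G u : ℕ) : ℝ) ≤
      ((3 * ∑ a ∈ A, w a * A.sup (D a) + n * 4 : ℕ) : ℝ) := by exact_mod_cast h1
    push_cast at h2
    simp only [E]
    linarith
  have hn0 : (0 : ℝ) < n := by
    rw [← hn]
    exact_mod_cast Fintype.card_pos
  have hk1 : (1 : ℝ) ≤ A.card := by
    exact_mod_cast Finset.card_pos.2 ⟨v, hvA⟩
  have hg : (0 : ℝ) ≤ (Δ : ℝ) - δ := by
    have : (δ : ℝ) ≤ Δ := by exact_mod_cast hδΔ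
    linarith
  have hd : (0 : ℝ) < (δ : ℝ) + 1 := by positivity
  rw [avec, hn, div_le_iff₀ hn0]
  generalize (∑ u, (ecc G u : ℝ)) = T at *
  generalize (∑ a ∈ A, (w a : ℝ) * E a) = W at *
  generalize (∑ a ∈ A, E a) = S at *
  clear hwsum hwE hsumc hsumcE hc hEb hwsumR
  obtain ⟨m, hm⟩ : ∃ m : ℝ, (A.card : ℝ) = m + 1 := ⟨A.card - 1, by ring⟩
  rw [hm] at hr hmain hS hk1
  obtain ⟨r, hrr⟩ : ∃ r : ℝ, r = n - (((δ : ℝ) + 1) * (m + 1) + (Δ - δ)) := ⟨_, rfl⟩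
  rw [← hrr] at hr hmain
  obtain ⟨s, hs⟩ : ∃ s : ℝ, r = s * ((δ : ℝ) + 1) := ⟨r / (δ + 1), by field_simp⟩
  have hs0 : 0 ≤ s := by
    by_contra hneg
    push Not at hneg
    nlinarith
  have hL : ((n : ℝ) - Δ - 1) / (δ + 1) = m + s := by
    rw [div_eq_iff hd.ne']
    linarith
  have hfin : ((9 / 4) * (((n : ℝ) - Δ - 1) / (δ + 1)) * (1 + ((Δ : ℝ) - δ) / (3 * n)) + 7) * n
      = (9 / 4) * (m + s) * (n + ((Δ : ℝ) - δ) / 3) + 7 * n := by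
    rw [hL]
    field_simp
  rw [hfin]
  have hm0 : 0 ≤ m := by linarith
  have hnn : (n : ℝ) = ((δ : ℝ) + 1) * (m + 1) + (Δ - δ) + r := by linarith
  have hSd : ((δ : ℝ) + 1) * (4 * S) ≤ (δ + 1) * (3 * (m + 1) ^ 2 - (m + 1)) :=
    mul_le_mul_of_nonneg_left (by linarith) hd.le
  generalize (Δ : ℝ) - δ = g at *
  generalize (δ : ℝ) + 1 = d at *
  generalize (n : ℝ) = N at *
  subst hnn
  subst hs
  have p1 : 0 ≤ s * d * m := by positivity
  have p2 : 0 ≤ s * g := by positivity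
  have p3 : 0 ≤ s * s * d := by positivity
  have p4 : 0 ≤ d * m := by positivity
  have p5 : 0 ≤ s * d := by positivity
  nlinarith
end

section
/- Let G be a connected triangle-free graph of order n with minimum degree δ ≥ 1 and maximum degree Δ. Then avec(G) ≤ (3/2)·((n−Δ)/δ)·(1 + (Δ−δ)/(3n)) + 19/2. -/
open SimpleGraph Finset

lemma aux_sum_max (D : ℕ) : 4 * ∑ i ∈ range (D + 1), max i (D - i) ≤ (3 * D + 1) * (D + 1) := by
  induction D using Nat.strong_induction_on with
  | _ D ih =>
    match D with
    | 0 => simp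
    | 1 => simp [Finset.sum_range_succ]
    | D + 2 =>
      have h := ih D (by omega)
      rw [Finset.sum_range_succ, Finset.sum_range_succ']
      have : ∑ k ∈ range (D + 1), max (k + 1) (D + 2 - (k + 1))
          = ∑ k ∈ range (D + 1), (max k (D - k) + 1) := by
        apply Finset.sum_congr rfl
        intro k hk
        have := Finset.mem_range.1 hk
        omega
      rw [this, Finset.sum_add_distrib]
      simp
      nlinarith

lemma aux_getVert_dist {W : Type*} {H : SimpleGraph W} (hH : H.Connected) {u v : W}
    (p : H.Walk u v) (i d : ℕ) (h : i + d ≤ p.length) :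
    H.dist (p.getVert i) (p.getVert (i + d)) ≤ d := by
  induction d with
  | zero => simp
  | succ d ih =>
    have h1 := ih (by omega)
    have h2 := hH.dist_triangle (u := p.getVert i) (v := p.getVert (i + d)) (w := p.getVert (i + d + 1))
    have h3 : H.dist (p.getVert (i + d)) (p.getVert (i + d + 1)) = 1 :=
      dist_eq_one_iff_adj.2 (p.adj_getVert_succ (by omega))
    rw [← add_assoc]; omega

lemma aux_append {W : Type*} {H : SimpleGraph W} {a b c : W} (q : H.Walk a b) (r : H.Walk b c)
    (hq : q.IsPath) (hr : r.IsPath) (hd : ∀ z ∈ q.support, z ∈ r.support → z = b) :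
    (q.append r).IsPath := by
  rw [Walk.isPath_def, Walk.support_append, List.nodup_append]
  have hr' := hr.support_nodup
  rw [← Walk.cons_tail_support] at hr'
  refine ⟨hq.support_nodup, (List.nodup_cons.1 hr').2, ?_⟩
  rintro z hz w hw rfl
  have := hd z hz (List.mem_of_mem_tail hw)
  subst this
  exact (List.nodup_cons.1 hr').1 hw

lemma aux_proj {W : Type*} {H : SimpleGraph W} (hH : H.Connected) {u v : W}
    (p : H.Walk u v) (hp : p.IsPath)
    (hmax : ∀ (u' v' : W) (q : H.Walk u' v'), q.IsPath → q.length ≤ p.length) (y : W) :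
    ∃ j s, s ≤ j ∧ s + j ≤ p.length ∧ H.dist (p.getVert j) y ≤ s := by
  classical
  obtain ⟨j, hj, hmin⟩ := Finset.exists_min_image (range (p.length + 1))
    (fun j => H.dist (p.getVert j) y) ⟨0, by simp⟩
  rw [Finset.mem_range] at hj
  obtain ⟨q, hq, hql⟩ := hH.exists_path_of_dist y (p.getVert j)
  have hdis : ∀ z ∈ q.support, z ∈ p.support → z = p.getVert j := by
    intro z hz hzp
    obtain ⟨i, hi, hil⟩ := Walk.mem_support_iff_exists_getVert.1 hzp
    have h1 := hmin i (by simp; omega)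
    simp only [hi] at h1
    have h2 := congrArg Walk.length (q.take_spec hz)
    rw [Walk.length_append] at h2
    have h3 := dist_le (q.takeUntil z hz)
    rw [dist_comm, H.dist_comm (u := z)] at h1
    have h4 : (q.dropUntil z hz).length = 0 := by omega
    exact Walk.eq_of_length_eq_zero h4
  have h1 := hmax _ _ _ (aux_append q (p.drop j) hq (hp.drop j) (fun z hz hz' => hdis z hz
    ((p.isSubwalk_drop j).support_subset hz')))
  have h2 := hmax _ _ _ (aux_append q (p.take j).reverse hq (hp.take j).reverse (fun z hz hz' => hdis z hz
    ((p.isSubwalk_take j).support_subset (by simpa using hz'))))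
  rw [Walk.length_append] at h1 h2
  simp at h1 h2
  rw [dist_comm] at hql
  exact ⟨j, H.dist (p.getVert j) y, by omega, by omega, le_rfl⟩

lemma aux_ecc {W : Type*} [Fintype W] (H : SimpleGraph W) (hH : H.Connected) :
    (∀ x, ecc H x + 1 ≤ Fintype.card W) ∧
    4 * ∑ x, ecc H x + 2 * Fintype.card W ≤ 3 * Fintype.card W ^ 2 := by
  classical
  have := hH.nonempty
  obtain ⟨u, v, p, hp, hmax⟩ := Walk.exists_isPath_forall_isPath_length_le_length H
  have hmax' : ∀ (u' v' : W) (q : H.Walk u' v'), q.IsPath → q.length ≤ p.length := by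
    intro u' v' q hq; exact hmax _ _ _ hq
  have hpr := aux_proj hH p hp hmax'
  have hlt := hp.length_lt
  have hd : ∀ i j, i ≤ p.length → j ≤ p.length →
      H.dist (p.getVert i) (p.getVert j) ≤ max i j - min i j := by
    intro i j hi hj
    rcases le_total i j with h | h
    · obtain ⟨d, rfl⟩ := Nat.exists_eq_add_of_le h
      have := aux_getVert_dist hH p i d hj
      omega
    · obtain ⟨d, rfl⟩ := Nat.exists_eq_add_of_le h
      have := aux_getVert_dist hH p j d hi
      rw [dist_comm]
      omega
  have hE : ∀ x, ecc H x ≤ p.length := by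
    intro x
    apply Finset.sup_le
    intro y _
    obtain ⟨j, s, h1, h2, h3⟩ := hpr x
    obtain ⟨j', s', h1', h2', h3'⟩ := hpr y
    have a1 := hH.dist_triangle (u := x) (v := p.getVert j) (w := y)
    have a2 := hH.dist_triangle (u := p.getVert j) (v := p.getVert j') (w := y)
    have a3 := hd j j' (by omega) (by omega)
    rw [dist_comm] at h3
    omega
  have hP : ∀ i ≤ p.length, ecc H (p.getVert i) ≤ max i (p.length - i) := by
    intro i hi
    apply Finset.sup_le
    intro y _
    obtain ⟨j', s', h1', h2', h3'⟩ := hpr y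
    have a2 := hH.dist_triangle (u := p.getVert i) (v := p.getVert j') (w := y)
    have a3 := hd i j' (by omega) (by omega)
    omega
  refine ⟨fun x => by have := hE x; omega, ?_⟩
  set S := (range (p.length + 1)).image p.getVert with hS
  have hinj : Set.InjOn p.getVert (range (p.length + 1) : Set ℕ) := by
    intro a ha b hb hab
    simp at ha hb
    exact hp.getVert_injOn (by simp; omega) (by simp; omega) hab
  have hScard : S.card = p.length + 1 := by
    rw [hS, Finset.card_image_of_injOn hinj]; simp
  have h1 : ∑ x ∈ S, ecc H x ≤ ∑ i ∈ range (p.length + 1), max i (p.length - i) := by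
    rw [hS, Finset.sum_image hinj]
    apply Finset.sum_le_sum
    intro i hi
    exact hP i (by have := Finset.mem_range.1 hi; omega)
  have h2 : ∑ x ∈ Sᶜ, ecc H x ≤ (Fintype.card W - (p.length + 1)) * p.length := by
    have := Finset.sum_le_card_nsmul Sᶜ (ecc H) p.length (fun x _ => hE x)
    rw [Finset.card_compl, hScard] at this
    simpa using this
  have h3 := aux_sum_max p.length
  rw [← Finset.sum_add_sum_compl S]
  obtain ⟨e, he⟩ := Nat.exists_eq_add_of_le (show p.length + 1 ≤ Fintype.card W by omega)
  rw [he] at h2 ⊢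
  rw [Nat.add_sub_cancel_left] at h2
  nlinarith

/-- `a` is an endpoint of the pair `e`. -/
def IsEnd {V : Type*} (a : V) (e : V × V) : Prop := a = e.1 ∨ a = e.2

/-- Auxiliary graph on pairs: two pairs are adjacent if they are at distance at most 3. -/
def auxH {V : Type*} (G : SimpleGraph V) : SimpleGraph (V × V) where
  Adj e f := e ≠ f ∧ ∃ a b, IsEnd a e ∧ IsEnd b f ∧ G.dist a b ≤ 3
  symm := ⟨by
    rintro e f ⟨h, a, b, ha, hb, hd⟩
    exact ⟨h.symm, b, a, hb, ha, by rwa [SimpleGraph.dist_comm]⟩⟩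
  loopless := ⟨by
    rintro e ⟨h, -⟩
    exact h rfl⟩

/-- Valid families of edges. -/
def GoodM {V : Type*} (G : SimpleGraph V) (e0 : V × V) (M : Finset (V × V)) : Prop :=
  e0 ∈ M ∧ (∀ e ∈ M, G.Adj e.1 e.2) ∧
  (∀ e ∈ M, ∀ f ∈ M, e ≠ f → ∀ a b, IsEnd a e → IsEnd b f → 3 ≤ G.dist a b) ∧
  ((auxH G).induce (M : Set (V × V))).Connected

lemma exists_goodM {V : Type*} [Fintype V] (G : SimpleGraph V) (hG : G.Connected)
    (e0 : V × V) (he0 : G.Adj e0.1 e0.2) :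
    ∃ M, GoodM G e0 M ∧ ∀ x, ∃ e ∈ M, ∃ a, IsEnd a e ∧ G.dist a x ≤ 3 := by
  classical
  obtain ⟨M, hM, hmax⟩ := Finset.exists_max_image
    ((Finset.univ : Finset (Finset (V × V))).filter (GoodM G e0)) Finset.card
    ⟨{e0}, by
      simp only [Finset.mem_filter, Finset.mem_univ, true_and]
      refine ⟨by simp, by simpa using he0, ?_, ?_⟩
      · intro e he f hf hne
        simp at he hf
        exact absurd (he.trans hf.symm) hne
      · rw [Finset.coe_singleton, induce_singleton_eq_top]
        exact connected_top⟩
  simp only [Finset.mem_filter, Finset.mem_univ, true_and] at hM hmax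
  refine ⟨M, hM, ?_⟩
  by_contra! hcon
  obtain ⟨x, hx⟩ := hcon
  obtain ⟨h1, h2, h3, h4⟩ := hM
  obtain ⟨w⟩ := hG.preconnected e0.1 x
  obtain ⟨d, hd, hdS, hdS'⟩ := w.exists_boundary_dart
    {y | ∃ e ∈ M, ∃ a, IsEnd a e ∧ G.dist a y ≤ 3}
    ⟨e0, h1, e0.1, Or.inl rfl, by simp⟩
    (by rintro ⟨e, he, a, ha, hh⟩; exact absurd hh (by have := hx e he a ha; omega))
  obtain ⟨⟨y, z⟩, hyz⟩ := d
  simp only at hdS hdS' hyz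
  obtain ⟨e, he, a, ha, hay⟩ := hdS
  have hz : ∀ e ∈ M, ∀ a, IsEnd a e → 4 ≤ G.dist a z := by
    intro e he a ha
    by_contra hlt
    exact hdS' ⟨e, he, a, ha, by omega⟩
  have hyz1 : G.dist y z = 1 := dist_eq_one_iff_adj.2 hyz
  have hy : ∀ e ∈ M, ∀ a, IsEnd a e → 3 ≤ G.dist a y := by
    intro e he a ha
    have := hz e he a ha
    have := hG.dist_triangle (u := a) (v := y) (w := z)
    omega
  have hyzE : ∀ e ∈ M, ∀ a b, IsEnd a e → IsEnd b (y, z) → 3 ≤ G.dist a b := by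
    intro e he a b ha hb
    rcases hb with rfl | rfl
    · exact hy e he a ha
    · have := hz e he a ha
      omega
  have hnot : (y, z) ∉ M := by
    intro hmem
    have := hz _ hmem z (Or.inr rfl)
    simp at this
  have hgood : GoodM G e0 (insert (y, z) M) := by
    refine ⟨by simp [h1], ?_, ?_, ?_⟩
    · intro f hf
      rcases Finset.mem_insert.1 hf with rfl | hf
      · exact hyz
      · exact h2 f hf
    · intro f hf g hg hfg a b ha hb
      rcases Finset.mem_insert.1 hf with rfl | hf
      · rcases Finset.mem_insert.1 hg with rfl | hg
        · exact absurd rfl hfg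
        · rw [SimpleGraph.dist_comm]; exact hyzE g hg b a hb ha
      · rcases Finset.mem_insert.1 hg with rfl | hg
        · exact hyzE f hf a b ha hb
        · exact h3 f hf g hg hfg a b ha hb
    · have hadj : (auxH G).Adj (y, z) e := by
        refine ⟨fun h => hnot (h ▸ he), y, a, Or.inl rfl, ha, by rwa [SimpleGraph.dist_comm]⟩
      have hs : ((auxH G).induce {(y, z)}).Connected := by
        rw [induce_singleton_eq_top]
        exact connected_top
      have := connected_induce_union (G := auxH G) (s := {(y, z)}) (t := (M : Set (V × V)))
        hs.preconnected h4.preconnected (Set.mem_singleton _) (Finset.mem_coe.2 he) hadj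
      rw [Finset.coe_insert, Set.insert_eq]
      exact this
  have := hmax _ hgood
  rw [Finset.card_insert_of_notMem hnot] at this
  omega

lemma aux_dist {V : Type*} (G : SimpleGraph V) (hG : G.Connected) (M : Finset (V × V))
    (hM : ∀ e ∈ M, G.Adj e.1 e.2) {e f : (M : Set (V × V))}
    (w : ((auxH G).induce (M : Set (V × V))).Walk e f) :
    ∀ a b, IsEnd a e.1 → IsEnd b f.1 → G.dist a b ≤ 4 * w.length + 1 := by
  have hself : ∀ e : (M : Set (V × V)), ∀ a b, IsEnd a e.1 → IsEnd b e.1 → G.dist a b ≤ 1 := by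
    intro e a b ha hb
    have h := dist_eq_one_iff_adj.2 (hM e.1 e.2)
    rcases ha with rfl | rfl <;> rcases hb with rfl | rfl
    · simp
    · omega
    · rw [SimpleGraph.dist_comm]; omega
    · simp
  induction w with
  | nil => simpa using hself _
  | @cons u v w h p ih =>
    intro a b ha hb
    have hh := h
    obtain ⟨-, a', b', ha', hb', hd⟩ := hh
    have t1 := hself _ a a' ha ha'
    have t2 := ih b' b hb' hb
    have t3 := hG.dist_triangle (u := a) (v := a') (w := b)
    have t4 := hG.dist_triangle (u := a') (v := b') (w := b)
    rw [Walk.length_cons]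
    omega

lemma aux_num (S E n k δ Δ : ℝ) (hS : S ≤ 7 * n + 4 * (2 * δ * E + (n - 2 * δ * k) * (k - 1)))
    (hE : 4 * E + 2 * k ≤ 3 * k ^ 2) (hn : Δ + 2 * δ * k ≤ n + δ) (hd : δ ≤ Δ) (_hk : 1 ≤ k)
    (hδ : 1 ≤ δ) (hn0 : 0 < n) :
    S / n ≤ (3 / 2) * ((n - Δ) / δ) * (1 + (Δ - δ) / (3 * n)) + 19 / 2 := by
  obtain ⟨A, hA⟩ : ∃ A, A = (n - Δ) / (2 * δ) := ⟨_, rfl⟩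
  have hA' : 2 * δ * A = n - Δ := by rw [hA]; field_simp
  have hkA : k ≤ A + 1 / 2 := by nlinarith
  have hrw : (3 / 2) * ((n - Δ) / δ) * (1 + (Δ - δ) / (3 * n)) + 19 / 2
      = (A * (3 * n + Δ - δ) + 19 / 2 * n) / n := by
    rw [hA]; field_simp; ring
  rw [hrw]
  apply div_le_div_of_nonneg_right _ hn0.le
  have hE' : 2 * δ * (4 * E) ≤ 2 * δ * (3 * k ^ 2 - 2 * k) :=
    mul_le_mul_of_nonneg_left (by linarith) (by linarith)
  have h1 : 0 ≤ (A + 1 / 2 - k) * (4 * n + 4 * δ - 2 * δ * (A + 1 / 2 + k)) := by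
    apply mul_nonneg (by linarith)
    nlinarith
  have hAA : 2 * δ * A * A = (n - Δ) * A := by rw [hA']
  nlinarith

theorem stmt4 {V : Type*} [Fintype V] (G : SimpleGraph V) [DecidableRel G.Adj]
    (hG : G.Connected) (hfree : G.CliqueFree 3)
    (n δ Δ : ℕ) (hn : Fintype.card V = n)
    (hδ : G.minDegree = δ) (hδ1 : 1 ≤ δ) (hΔ : G.maxDegree = Δ) :
    avec G ≤ (3 / 2) * (((n : ℝ) - Δ) / δ) * (1 + ((Δ : ℝ) - δ) / (3 * n)) + 19 / 2 := by
  classical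
  have := hG.nonempty
  obtain ⟨v0, hv0⟩ := G.exists_maximal_degree_vertex
  have hdeg : ∀ v, δ ≤ G.degree v := fun v => hδ ▸ G.minDegree_le_degree v
  obtain ⟨w0, hw0⟩ := (G.degree_pos_iff_exists_adj (v := v0)).1 (by have := hdeg v0; omega)
  obtain ⟨M, ⟨hM0, hM1, hM2, hM3⟩, hcov⟩ := exists_goodM G hG (v0, w0) hw0
  set H := (auxH G).induce (M : Set (V × V)) with hH
  obtain ⟨hE1, hE2⟩ := aux_ecc H hM3
  obtain ⟨k, hk⟩ : ∃ k, k = Fintype.card (M : Set (V × V)) := ⟨_, rfl⟩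
  rw [← hk] at hE2
  -- assignment
  have hass : ∀ x, ∃ e : (M : Set (V × V)), (∃ a, IsEnd a e.1 ∧ G.dist a x ≤ 3) ∧
      ∀ f : (M : Set (V × V)), (∃ a, IsEnd a f.1 ∧ G.Adj a x) → e = f := by
    intro x
    by_cases hx : ∃ f : (M : Set (V × V)), ∃ a, IsEnd a f.1 ∧ G.Adj a x
    · obtain ⟨e, a, ha, hax⟩ := hx
      have h1 := dist_eq_one_iff_adj.2 hax
      refine ⟨e, ⟨a, ha, by omega⟩, ?_⟩
      rintro f ⟨b, hb, hbx⟩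
      by_contra hne
      have h2 := dist_eq_one_iff_adj.2 hbx.symm
      have h3 := hM2 e.1 e.2 f.1 f.2 (fun h => hne (Subtype.ext h)) a b ha hb
      have h4 := hG.dist_triangle (u := a) (v := x) (w := b)
      omega
    · obtain ⟨e, he, a, ha, hd⟩ := hcov x
      refine ⟨⟨e, he⟩, ⟨a, ha, hd⟩, ?_⟩
      intro f hf
      exact absurd ⟨f, hf⟩ hx
  choose β hβ1 hβ2 using hass
  have hecc : ∀ x, ecc G x ≤ 4 * ecc H (β x) + 7 := by
    intro x
    apply Finset.sup_le
    intro y _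
    obtain ⟨a, ha, hax⟩ := hβ1 x
    obtain ⟨b, hb, hby⟩ := hβ1 y
    obtain ⟨w, hw⟩ := hM3.exists_walk_length_eq_dist (β x) (β y)
    have h1 := aux_dist G hG M hM1 w a b ha hb
    have h2 : H.dist (β x) (β y) ≤ ecc H (β x) :=
      Finset.le_sup (f := H.dist (β x)) (Finset.mem_univ _)
    have t1 := hG.dist_triangle (u := x) (v := a) (w := y)
    have t2 := hG.dist_triangle (u := a) (v := b) (w := y)
    rw [SimpleGraph.dist_comm] at hax
    omega
  obtain ⟨c, hc⟩ : ∃ c : ↥(M : Set (V × V)) → ℕ,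
      c = fun e => (Finset.univ.filter (fun x => β x = e)).card := ⟨_, rfl⟩
  have hcdeg : ∀ e : (M : Set (V × V)), G.degree e.1.1 + G.degree e.1.2 ≤ c e := by
    intro e
    have hadj := hM1 e.1 e.2
    rw [← G.card_neighborFinset_eq_degree, ← G.card_neighborFinset_eq_degree,
      ← Finset.card_union_of_disjoint, hc]
    · apply Finset.card_le_card
      intro x hx
      simp only [Finset.mem_union, mem_neighborFinset] at hx
      simp only [Finset.mem_filter, Finset.mem_univ, true_and]
      apply hβ2
      rcases hx with hx | hx
      · exact ⟨_, Or.inl rfl, hx⟩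
      · exact ⟨_, Or.inr rfl, hx⟩
    · rw [Finset.disjoint_left]
      intro x hx hx'
      rw [mem_neighborFinset] at hx hx'
      exact hfree {e.1.1, e.1.2, x} (is3Clique_triple_iff.2 ⟨hadj, hx, hx'⟩)
  have hcsum : ∑ e, c e = n := by
    rw [hc, ← hn, ← Finset.card_univ (α := V)]
    exact (Finset.card_eq_sum_card_fiberwise (fun x _ => Finset.mem_univ (β x))).symm
  have hsum : ∑ x, ecc H (β x) = ∑ e, c e * ecc H e := by
    rw [hc, ← Finset.sum_fiberwise' Finset.univ β (fun e => ecc H e)]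
    simp
  have hc2 : ∀ e, 2 * δ ≤ c e := by
    intro e
    have := hcdeg e
    have := hdeg e.1.1
    have := hdeg e.1.2
    omega
  have hnk : Δ + 2 * δ * k ≤ n + δ := by
    have h1 := Finset.single_le_sum (f := fun e => c e - 2 * δ) (fun e _ => Nat.zero_le _)
      (Finset.mem_univ (⟨(v0, w0), hM0⟩ : (M : Set (V × V))))
    have h2 : ∑ e, (c e - 2 * δ) + 2 * δ * k = n := by
      have : ∑ e : (M : Set (V × V)), 2 * δ = 2 * δ * k := by
        rw [Finset.sum_const, Finset.card_univ, ← hk, smul_eq_mul, mul_comm]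
      rw [← hcsum, ← this, ← Finset.sum_add_distrib]
      exact Finset.sum_congr rfl (fun e _ => Nat.sub_add_cancel (hc2 e))
    have h3 := hcdeg ⟨(v0, w0), hM0⟩
    have h4 := hdeg w0
    simp only at h1 h3
    omega
  have hk1 : 1 ≤ k := by
    rw [hk]
    exact Fintype.card_pos_iff.2 ⟨⟨(v0, w0), hM0⟩⟩
  have hΔδ : δ ≤ Δ := by rw [← hΔ, hv0]; exact hdeg v0
  have hn0 : 0 < n := by rw [← hn]; exact Fintype.card_pos
  have hbd : (∑ e, (c e : ℝ) * (ecc H e : ℝ)) ≤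
      2 * δ * (∑ e, (ecc H e : ℝ)) + ((n : ℝ) - 2 * δ * k) * (k - 1) := by
    have h1 : ∀ e, (c e : ℝ) * (ecc H e : ℝ) ≤
        2 * δ * (ecc H e : ℝ) + ((c e : ℝ) - 2 * δ) * (k - 1) := by
      intro e
      have a1 : (2 * δ : ℝ) ≤ c e := by exact_mod_cast hc2 e
      have a2 : (ecc H e : ℝ) + 1 ≤ k := by rw [hk]; exact_mod_cast hE1 e
      nlinarith
    refine (Finset.sum_le_sum (fun e _ => h1 e)).trans (le_of_eq ?_)
    rw [Finset.sum_add_distrib, ← Finset.mul_sum, ← Finset.sum_mul, Finset.sum_sub_distrib,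
      Finset.sum_const, Finset.card_univ, ← hk, ← hcsum, Nat.cast_sum, nsmul_eq_mul]
    ring
  have hS : (∑ x, (ecc G x : ℝ)) ≤
      7 * n + 4 * (2 * δ * (∑ e, (ecc H e : ℝ)) + ((n : ℝ) - 2 * δ * k) * (k - 1)) := by
    have h1 : ∑ x, ecc G x ≤ 4 * (∑ e, c e * ecc H e) + 7 * n := by
      rw [← hsum, ← hn, Finset.mul_sum]
      refine (Finset.sum_le_sum (fun x _ => hecc x)).trans (le_of_eq ?_)
      rw [Finset.sum_add_distrib, Finset.sum_const, Finset.card_univ, smul_eq_mul, mul_comm 7]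
    have h2 : (∑ x, (ecc G x : ℝ)) ≤ 4 * (∑ e, (c e : ℝ) * (ecc H e : ℝ)) + 7 * n := by
      exact_mod_cast h1
    linarith
  have hE3 : 4 * (∑ e, (ecc H e : ℝ)) + 2 * k ≤ 3 * (k : ℝ) ^ 2 := by exact_mod_cast hE2
  unfold avec
  rw [hn]
  exact aux_num _ _ n k δ Δ hS hE3 (by exact_mod_cast hnk) (by exact_mod_cast hΔδ)
    (by exact_mod_cast hk1) (by exact_mod_cast hδ1) (by exact_mod_cast hn0)
end

section
/- Let G be a connected graph and A ⊆ V(G). For each vertex x, let x_A be a vertex of A nearest to x, and suppose d_G(x, x_A) ≤ r for all x. Define c(u) = |{x ∈ V(G) : x_A = u}| for u ∈ V(G). Then avec(G) ≤ avec_c(G) + r, where avec_c(G) = (1/n)·∑_{u} c(u)·e_G(u) and n = |V(G)|. -/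
open SimpleGraph Finset

/-- G contains no 4-cycle as a (not necessarily induced) subgraph. -/
def C4Free {V : Type*} (G : SimpleGraph V) : Prop :=
  ¬ ∃ a b c d : V, a ≠ c ∧ b ≠ d ∧ G.Adj a b ∧ G.Adj b c ∧ G.Adj c d ∧ G.Adj d a

/-- The set of vertices within distance 2 of v (the second closed neighbourhood). -/
def N2 {V : Type*} (G : SimpleGraph V) (v : V) : Set V :=
  {x | x = v ∨ G.Adj v x ∨ ∃ w, G.Adj v w ∧ G.Adj w x}

theorem stmt10 {V : Type*} [Fintype V] [DecidableEq V] (G : SimpleGraph V)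
    (hG : G.Connected)
    (A : Set V) (f : V → V) (hfA : ∀ x, f x ∈ A)
    (hnear : ∀ x, ∀ a ∈ A, G.dist x (f x) ≤ G.dist x a)
    (r : ℕ) (hr : ∀ x, G.dist x (f x) ≤ r)
    (c : V → ℕ) (hc : ∀ u, c u = (Finset.univ.filter (fun x => f x = u)).card) :
    avec G ≤ (∑ u, (c u : ℝ) * (ecc G u : ℝ)) / (Fintype.card V) + r := by
  have hecc : ∀ x, ecc G x ≤ ecc G (f x) + r := by
    intro x
    unfold ecc
    refine Finset.sup_le fun y _ => ?_
    have h1 : G.dist x y ≤ G.dist x (f x) + G.dist (f x) y := hG.dist_triangle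
    have h2 : G.dist (f x) y ≤ Finset.univ.sup (G.dist (f x)) :=
      Finset.le_sup (f := G.dist (f x)) (Finset.mem_univ y)
    have h3 := hr x
    omega
  have hsum : ∑ u, (c u : ℝ) * (ecc G u : ℝ) = ∑ x, (ecc G (f x) : ℝ) := by
    rw [← Finset.sum_fiberwise (s := Finset.univ) (g := f) (f := fun x => (ecc G (f x) : ℝ))]
    refine Finset.sum_congr rfl fun u _ => ?_
    rw [hc u, ← nsmul_eq_mul, ← Finset.sum_const]
    refine Finset.sum_congr rfl fun x hx => ?_
    rw [(Finset.mem_filter.mp hx).2]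
  have hne : Nonempty V := hG.nonempty
  have hn : (0 : ℝ) < Fintype.card V := by exact_mod_cast Fintype.card_pos
  rw [hsum, avec, div_add' _ _ _ hn.ne']
  refine div_le_div_of_nonneg_right ?_ hn.le
  calc ∑ v, (ecc G v : ℝ) ≤ ∑ x, ((ecc G (f x) : ℝ) + r) :=
        Finset.sum_le_sum fun x _ => by exact_mod_cast hecc x
    _ = ∑ x, (ecc G (f x) : ℝ) + r * Fintype.card V := by
        rw [Finset.sum_add_distrib, Finset.sum_const, Finset.card_univ, nsmul_eq_mul, mul_comm (r : ℝ)]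
end
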